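/- Let n ≥ 1, 0 < δ < 1, a ∈ S^{-n}_{0,δ}, and λ ≥ 1. There is a constant C (depending on n, δ, λ and finitely many seminorms of a) such that for every 0 < l < 1, every positive integer j with 2^j ≥ l^{-1}, every x_0 ∈ ℝⁿ, and every Schwartz function u: |Q(x_0,l)|^{-1} ∫_{Q(x_0,l)} |T_j u(x)| dx ≤ C (2^{jδ} l^λ + l^{−nλ/2} 2^{−jn/2}) Mu(x_0). -/

import Mathlib

open MeasureTheory Real
open scoped ENNReal NNReal InnerProductSpace BigOperators

noncomputable section

/-- `ℝⁿ` with its Euclidean structure. -/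
abbrev Rn (n : ℕ) : Type := EuclideanSpace ℝ (Fin n)

/-- The Fourier transform `û(ξ) = ∫ e^{-i⟨x,ξ⟩} u(x) dx`. -/
def ft {n : ℕ} (u : Rn n → ℂ) (ξ : Rn n) : ℂ :=
  ∫ x : Rn n, Complex.exp (-(Complex.I * ((⟪x, ξ⟫_ℝ : ℝ) : ℂ))) * u x

/-- The pseudo-differential operator `T_a u(x) = ∫ e^{i⟨x,ξ⟩} a(x,ξ) û(ξ) dξ`. -/
def pdo {n : ℕ} (a : Rn n → Rn n → ℂ) (u : Rn n → ℂ) (x : Rn n) : ℂ :=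
  ∫ ξ : Rn n, Complex.exp (Complex.I * ((⟪x, ξ⟫_ℝ : ℝ) : ℂ)) * a x ξ * ft u ξ

/-- The dual operator `T_a^* u(x) = ∫∫ e^{i⟨x-y,ξ⟩} a(y,ξ) dξ u(y) dy`. -/
def pdoDual {n : ℕ} (a : Rn n → Rn n → ℂ) (u : Rn n → ℂ) (x : Rn n) : ℂ :=
  ∫ y : Rn n,
    (∫ ξ : Rn n, Complex.exp (Complex.I * ((⟪x - y, ξ⟫_ℝ : ℝ) : ℂ)) * a y ξ) * u y

/-- The Hörmander symbol class `S^m_{ϱ,δ}`: `a` is smooth and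
`|∂^β_x ∂^α_ξ a(x,ξ)| ≤ C_{α,β} (1+|ξ|²)^{(m-ϱ|α|+δ|β|)/2}`. -/
def HormClass {n : ℕ} (m ϱ δ : ℝ) (a : Rn n → Rn n → ℂ) : Prop :=
  ContDiff ℝ (⊤ : ℕ∞) (Function.uncurry a) ∧
  ∀ k l : ℕ, ∃ C : ℝ, 0 < C ∧ ∀ x ξ : Rn n,
    ‖iteratedFDeriv ℝ l (fun y : Rn n => iteratedFDeriv ℝ k (fun η : Rn n => a y η) ξ) x‖ ≤
      C * (1 + ‖ξ‖ ^ 2) ^ ((m - ϱ * k + δ * l) / 2)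

/-- The rough Hörmander class `L^∞S^m_ϱ`: `a(x,ξ)` is smooth in `ξ`, bounded measurable in `x`,
and `‖∂^α_ξ a(·,ξ)‖_{L^∞} ≤ C_α (1+|ξ|²)^{(m-ϱ|α|)/2}`. -/
def RoughClass {n : ℕ} (m ϱ : ℝ) (a : Rn n → Rn n → ℂ) : Prop :=
  (∀ x : Rn n, ContDiff ℝ (⊤ : ℕ∞) (a x)) ∧
  (∀ ξ : Rn n, Measurable fun x : Rn n => a x ξ) ∧
  ∀ k : ℕ, ∃ C : ℝ, 0 < C ∧ ∀ ξ : Rn n, ∀ᵐ x : Rn n ∂volume,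
    ‖iteratedFDeriv ℝ k (a x) ξ‖ ≤ C * (1 + ‖ξ‖ ^ 2) ^ ((m - ϱ * k) / 2)

/-- The axis-parallel cube centered at `x₀` with side length `l`. -/
def cube {n : ℕ} (x₀ : Rn n) (l : ℝ) : Set (Rn n) :=
  {y | ∀ i, |y i - x₀ i| ≤ l / 2}

/-- The Hardy–Littlewood maximal function over axis-parallel cubes. -/
def mHL {n : ℕ} {E : Type*} [NormedAddCommGroup E] (u : Rn n → E) (x : Rn n) : ℝ≥0∞ :=
  ⨆ (x₀ : Rn n) (l : ℝ) (_ : 0 < l) (_ : x ∈ cube x₀ l),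
    (∫⁻ y in cube x₀ l, (‖u y‖₊ : ℝ≥0∞)) / ENNReal.ofReal (l ^ n)

/-- The Fefferman–Stein sharp maximal function over axis-parallel cubes. -/
def mSharp {n : ℕ} (u : Rn n → ℂ) (x : Rn n) : ℝ≥0∞ :=
  ⨆ (x₀ : Rn n) (l : ℝ) (_ : 0 < l) (_ : x ∈ cube x₀ l),
    ⨅ c : ℂ, (∫⁻ y in cube x₀ l, (‖u y - c‖₊ : ℝ≥0∞)) / ENNReal.ofReal (l ^ n)

/-- The Muckenhoupt `A₁` condition: `Mω ≤ C ω` a.e. -/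
def IsA1 {n : ℕ} (ω : Rn n → ℝ) : Prop :=
  (∀ x, 0 ≤ ω x) ∧ LocallyIntegrable ω volume ∧
  ∃ C : ℝ, 0 < C ∧ ∀ᵐ x : Rn n ∂volume, mHL ω x ≤ ENNReal.ofReal (C * ω x)

/-- The Muckenhoupt `A_p` condition for `1 < p < ∞`. -/
def IsAp {n : ℕ} (p : ℝ) (ω : Rn n → ℝ) : Prop :=
  (∀ x, 0 ≤ ω x) ∧ LocallyIntegrable ω volume ∧
  ∃ C : ℝ, 0 < C ∧ ∀ (x₀ : Rn n) (l : ℝ), 0 < l →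
    ((∫⁻ y in cube x₀ l, ENNReal.ofReal (ω y)) / ENNReal.ofReal (l ^ n)) *
      (((∫⁻ y in cube x₀ l, ENNReal.ofReal (ω y ^ (1 / (1 - p)))) /
          ENNReal.ofReal (l ^ n)) ^ (p - 1))
      ≤ ENNReal.ofReal C

/-- The weighted measure `ω(s) = ∫_s ω dx`. -/
def wMeas {n : ℕ} (ω : Rn n → ℝ) (s : Set (Rn n)) : ℝ≥0∞ :=
  ∫⁻ x in s, ENNReal.ofReal (ω x)

/-- The weighted `L¹` norm `∫ |u| ω dx`. -/
def wL1 {n : ℕ} (ω : Rn n → ℝ) (u : Rn n → ℂ) : ℝ≥0∞ :=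
  ∫⁻ x : Rn n, (‖u x‖₊ : ℝ≥0∞) * ENNReal.ofReal (ω x)

/-- The weighted `L^p` norm `(∫ |u|^p ω dx)^{1/p}`. -/
def wLp {n : ℕ} (p : ℝ) (ω : Rn n → ℝ) (u : Rn n → ℂ) : ℝ≥0∞ :=
  (∫⁻ x : Rn n, (‖u x‖₊ : ℝ≥0∞) ^ p * ENNReal.ofReal (ω x)) ^ (1 / p)

/-- A Littlewood–Paley cut-off: `ψ ∈ C_c^∞`, `0 ≤ ψ ≤ 1`, supported in the annulus
`{C₀⁻¹ ≤ |ξ| ≤ 2C₀}`. -/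
def LPcut {n : ℕ} (C₀ : ℝ) (ψ : Rn n → ℝ) : Prop :=
  ContDiff ℝ (⊤ : ℕ∞) ψ ∧ HasCompactSupport ψ ∧ (∀ ξ, 0 ≤ ψ ξ) ∧ (∀ ξ, ψ ξ ≤ 1) ∧
  tsupport ψ ⊆ {ξ : Rn n | C₀⁻¹ ≤ ‖ξ‖ ∧ ‖ξ‖ ≤ 2 * C₀}

/-- `K_j(x,y) = (2π)^{-n} ∫ e^{i⟨x-y,ξ⟩} a(x,ξ) ψ(2^{-j}ξ) dξ`. -/
def Kj {n : ℕ} (a : Rn n → Rn n → ℂ) (ψ : Rn n → ℝ) (j : ℕ) (x y : Rn n) : ℂ :=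
  ((((2 * π) ^ n)⁻¹ : ℝ) : ℂ) *
    ∫ ξ : Rn n, Complex.exp (Complex.I * ((⟪x - y, ξ⟫_ℝ : ℝ) : ℂ)) * a x ξ *
      ((ψ ((((2 : ℝ) ^ j)⁻¹) • ξ) : ℝ) : ℂ)

/-- `K_j^*(x,y) = (2π)^{-n} ∫ e^{i⟨x-y,ξ⟩} a(y,ξ) ψ(2^{-j}ξ) dξ`. -/
def KjStar {n : ℕ} (a : Rn n → Rn n → ℂ) (ψ : Rn n → ℝ) (j : ℕ) (x y : Rn n) : ℂ :=
  ((((2 * π) ^ n)⁻¹ : ℝ) : ℂ) *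
    ∫ ξ : Rn n, Complex.exp (Complex.I * ((⟪x - y, ξ⟫_ℝ : ℝ) : ℂ)) * a y ξ *
      ((ψ ((((2 : ℝ) ^ j)⁻¹) • ξ) : ℝ) : ℂ)

/-- `T_j u(x) = ∫ K_j(x,y) u(y) dy`. -/
def Tj {n : ℕ} (a : Rn n → Rn n → ℂ) (ψ : Rn n → ℝ) (j : ℕ) (u : Rn n → ℂ) (x : Rn n) : ℂ :=
  ∫ y : Rn n, Kj a ψ j x y * u y

/-- `T_j^* u(x) = ∫ K_j^*(x,y) u(y) dy`. -/
def TjStar {n : ℕ} (a : Rn n → Rn n → ℂ) (ψ : Rn n → ℝ) (j : ℕ) (u : Rn n → ℂ) (x : Rn n) : ℂ :=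
  ∫ y : Rn n, KjStar a ψ j x y * u y

/-- The Fourier integral operator `T_{a,φ} u(x) = ∫ e^{iφ(x,ξ)} a(x,ξ) û(ξ) dξ`. -/
def fio {n : ℕ} (a : Rn n → Rn n → ℂ) (φ : Rn n → Rn n → ℝ) (u : Rn n → ℂ) (x : Rn n) : ℂ :=
  ∫ ξ : Rn n, Complex.exp (Complex.I * ((φ x ξ : ℝ) : ℂ)) * a x ξ * ft u ξ

/-- The dual FIO `T^*_{a,φ} u(x) = ∫∫ e^{i(φ(y,ξ)-⟨x,ξ⟩)} a(y,ξ) dξ u(y) dy`. -/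
def fioDual {n : ℕ} (a : Rn n → Rn n → ℂ) (φ : Rn n → Rn n → ℝ) (u : Rn n → ℂ) (x : Rn n) : ℂ :=
  ∫ y : Rn n,
    (∫ ξ : Rn n, Complex.exp (Complex.I * ((φ y ξ - ⟪x, ξ⟫_ℝ : ℝ) : ℂ)) * a y ξ) * u y

/-- The phase class `Φ¹`: smooth on `ℝⁿ × (ℝⁿ∖{0})`, positively homogeneous of degree 1 in `ξ`,
with `sup |ξ|^{-1+|α|} |∂^α_ξ ∂^β_x φ| ≤ C_{α,β}` for `|α|+|β| ≥ 1`. -/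
def Phi1 {n : ℕ} (φ : Rn n → Rn n → ℝ) : Prop :=
  ContDiffOn ℝ (⊤ : ℕ∞) (Function.uncurry φ) {p : Rn n × Rn n | p.2 ≠ 0} ∧
  (∀ x : Rn n, ∀ ξ : Rn n, ξ ≠ 0 → ∀ t : ℝ, 0 < t → φ x (t • ξ) = t * φ x ξ) ∧
  ∀ k l : ℕ, 1 ≤ k + l → ∃ C : ℝ, 0 < C ∧ ∀ x ξ : Rn n, ξ ≠ 0 →
    ‖ξ‖ ^ ((k : ℝ) - 1) *
        ‖iteratedFDeriv ℝ k (fun η : Rn n => iteratedFDeriv ℝ l (fun y : Rn n => φ y η) x) ξ‖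
      ≤ C

/-- The rough phase class `L^∞Φ¹`: positively homogeneous of degree 1 in `ξ`, smooth in `ξ` away
from the origin, bounded measurable in `x`, with `sup |ξ|^{-1+|α|} ‖∂^α_ξ φ(·,ξ)‖_{L^∞} ≤ C_α`
for `|α| ≥ 1`. -/
def LinfPhi1 {n : ℕ} (φ : Rn n → Rn n → ℝ) : Prop :=
  (∀ x : Rn n, ContDiffOn ℝ (⊤ : ℕ∞) (φ x) {ξ : Rn n | ξ ≠ 0}) ∧
  (∀ ξ : Rn n, Measurable fun x : Rn n => φ x ξ) ∧
  (∀ ξ : Rn n, ∃ C : ℝ, ∀ x : Rn n, |φ x ξ| ≤ C) ∧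
  (∀ x : Rn n, ∀ ξ : Rn n, ξ ≠ 0 → ∀ t : ℝ, 0 < t → φ x (t • ξ) = t * φ x ξ) ∧
  ∀ k : ℕ, 1 ≤ k → ∃ C : ℝ, 0 < C ∧ ∀ ξ : Rn n, ξ ≠ 0 → ∀ᵐ x : Rn n ∂volume,
    ‖ξ‖ ^ ((k : ℝ) - 1) * ‖iteratedFDeriv ℝ k (φ x) ξ‖ ≤ C

/-- The oscillatory integral `∫ e^{i⟨z,ξ⟩} b(ξ) dξ`. -/
def osc {n : ℕ} (b : Rn n → ℂ) (z : Rn n) : ℂ :=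
  ∫ ξ : Rn n, Complex.exp (Complex.I * ((⟪z, ξ⟫_ℝ : ℝ) : ℂ)) * b ξ

open FourierTransform LineDeriv SchwartzMap in
lemma osc_eq_fourier {n : ℕ} (b : Rn n → ℂ) (z : Rn n) :
    osc b z = 𝓕 b (-(2 * π)⁻¹ • z) := by
  rw [Real.fourier_eq', osc]
  congr 1
  ext ξ
  rw [smul_eq_mul, inner_smul_right, real_inner_comm]
  congr 2
  push_cast
  field_simp

open FourierTransform LineDeriv SchwartzMap in
lemma norm_fourier_iterate_lineDeriv {n : ℕ} (f : 𝓢(Rn n, ℂ)) (m w : Rn n) (N : ℕ) :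
    ‖𝓕 (∂^{fun _ : Fin N => m} f) w‖ = (2 * π * |⟪w, m⟫_ℝ|) ^ N * ‖𝓕 f w‖ := by
  have hg : Function.HasTemperateGrowth (fun v : Rn n => ⟪v, m⟫_ℝ) := by fun_prop
  induction N with
  | zero => simp
  | succ N ih =>
    rw [iteratedLineDerivOp_succ_left, fourier_lineDerivOp_eq]
    have : Fin.tail (fun _ : Fin (N + 1) => m) = fun _ : Fin N => m := rfl
    rw [this, smul_apply, smulLeftCLM_apply_apply hg, norm_smul, norm_smul, ih]
    simp only [Complex.norm_mul, Complex.norm_ofNat, Complex.norm_real, Real.norm_eq_abs,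
      Complex.norm_I, mul_one, abs_of_pos Real.pi_pos]
    ring

lemma EuclideanSpace.norm_le_sum_abs {n : ℕ} (z : Rn n) : ‖z‖ ≤ ∑ i, |z i| := by
  rw [EuclideanSpace.norm_eq]
  apply Real.sqrt_le_iff.2 ⟨by positivity, ?_⟩
  simpa using Finset.sum_sq_le_sq_sum_of_nonneg (s := Finset.univ) (f := fun i => |z i|) (by simp)

lemma one_add_norm_pow_le {n : ℕ} (N : ℕ) (z : Rn n) :
    (1 + ‖z‖) ^ (N + 1) ≤ (n + 1 : ℝ) ^ N * (1 + ∑ i, |z i| ^ (N + 1)) := by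
  have h := pow_sum_div_card_le_sum_pow (s := (Finset.univ : Finset (Option (Fin n))))
    (f := fun o => o.elim (1 : ℝ) fun i => |z i|) (by rintro (_ | i) _ <;> simp) N
  simp only [Fintype.sum_option, Option.elim, Finset.card_univ, Fintype.card_option,
    Fintype.card_fin, one_pow] at h
  rw [div_le_iff₀ (by positivity)] at h
  push_cast at h
  calc (1 + ‖z‖) ^ (N + 1) ≤ (1 + ∑ i, |z i|) ^ (N + 1) := by
        have := EuclideanSpace.norm_le_sum_abs z
        gcongr
    _ ≤ _ := by linarith

open FourierTransform LineDeriv SchwartzMap in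
lemma weight_mul_norm_osc_le {n : ℕ} (N : ℕ) (f : 𝓢(Rn n, ℂ)) (z : Rn n) :
    (1 + ‖z‖) ^ (N + 1) * ‖osc f z‖ ≤ (n + 1 : ℝ) ^ N * (‖𝓕 f (-(2 * π)⁻¹ • z)‖ +
      ∑ i : Fin n, ‖𝓕 (∂^{fun _ : Fin (N + 1) => (EuclideanSpace.single i (1 : ℝ) : Rn n)} f)
        (-(2 * π)⁻¹ • z)‖) := by
  have hc (i : Fin n) : 2 * π * |⟪-(2 * π)⁻¹ • z, EuclideanSpace.single i (1 : ℝ)⟫_ℝ| = |z i| := by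
    rw [inner_smul_left, EuclideanSpace.inner_single_right]
    simp [abs_mul, abs_of_pos Real.pi_pos]
    field_simp
  simp only [norm_fourier_iterate_lineDeriv, hc]
  rw [osc_eq_fourier, SchwartzMap.fourier_coe, ← Finset.sum_mul, ← one_add_mul, ← mul_assoc]
  gcongr
  exact one_add_norm_pow_le N z

open FourierTransform in
lemma SchwartzMap.norm_fourier_le_of_norm_le_indicator {n : ℕ} (f : SchwartzMap (Rn n) ℂ) {A : ℝ}
    {S : Set (Rn n)} (hS : MeasurableSet S) (hfin : volume S ≠ ⊤)
    (hf : ∀ ξ, ‖f ξ‖ ≤ S.indicator (fun _ => A) ξ) (w : Rn n) :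
    ‖𝓕 f w‖ ≤ A * volume.real S := by
  have h1 : ‖𝓕 f w‖ ≤ ∫ v, ‖f v‖ := by
    rw [SchwartzMap.fourier_coe]
    exact VectorFourier.norm_fourierIntegral_le_integral_norm _ _ _ _ _
  refine h1.trans ((integral_mono f.integrable.norm ?_ hf).trans ?_)
  · exact (integrable_indicator_iff hS).2 (integrableOn_const hfin)
  · rw [integral_indicator_const _ hS, smul_eq_mul, mul_comm]

open FourierTransform in
lemma SchwartzMap.lintegral_fourier_sq_le {n : ℕ} (f : SchwartzMap (Rn n) ℂ) {A : ℝ}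
    {S : Set (Rn n)} (hS : MeasurableSet S) (hfin : volume S ≠ ⊤)
    (hf : ∀ ξ, ‖f ξ‖ ≤ S.indicator (fun _ => A) ξ) :
    ∫⁻ w, ENNReal.ofReal (‖𝓕 f w‖ ^ 2) ≤ ENNReal.ofReal (A ^ 2 * volume.real S) := by
  have hi (g : SchwartzMap (Rn n) ℂ) : Integrable (fun w => ‖g w‖ ^ 2) := by
    have := (g.memLp 2 volume).integrable_norm_pow (by norm_num)
    simpa using this
  rw [← ofReal_integral_eq_lintegral_ofReal (hi _) (.of_forall fun _ => by positivity),
    SchwartzMap.integral_norm_sq_fourier]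
  apply ENNReal.ofReal_le_ofReal
  calc ∫ x, ‖f x‖ ^ 2 ≤ ∫ x, S.indicator (fun _ => A ^ 2) x := by
        refine integral_mono (hi f) ((integrable_indicator_iff hS).2 (integrableOn_const hfin)) ?_
        intro x
        have := hf x
        by_cases hx : x ∈ S
        · simp only [Set.indicator_of_mem hx] at this ⊢
          gcongr
        · simp only [Set.indicator_of_notMem hx] at this ⊢
          have : ‖f x‖ = 0 := le_antisymm this (norm_nonneg _)
          simp [this]
    _ = _ := by rw [integral_indicator_const _ hS, smul_eq_mul, mul_comm]

lemma lintegral_comp_neg_inv_two_pi_smul {n : ℕ} (F : Rn n → ℝ≥0∞) (hF : Measurable F) :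
    ∫⁻ z, F (-(2 * π)⁻¹ • z) = ENNReal.ofReal ((2 * π) ^ n) * ∫⁻ w, F w := by
  have h0 : (-(2 * π)⁻¹ : ℝ) ≠ 0 := by simp [Real.pi_ne_zero]
  rw [← lintegral_map (f := F) hF (measurable_const_smul _),
    Measure.map_addHaar_smul _ h0, lintegral_smul_measure, smul_eq_mul]
  congr 2
  rw [finrank_euclideanSpace_fin, abs_inv, abs_pow, abs_neg, abs_inv, inv_pow, inv_inv,
    abs_of_pos (by positivity)]

open FourierTransform LineDeriv SchwartzMap in
/-- The function itself together with its pure derivatives of order `N` in the coordinate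
directions. -/
def pureDerivs {n : ℕ} (N : ℕ) (f : 𝓢(Rn n, ℂ)) : Option (Fin n) → 𝓢(Rn n, ℂ)
  | none => f
  | some i => ∂^{fun _ : Fin N => (EuclideanSpace.single i (1 : ℝ) : Rn n)} f

lemma norm_pureDerivs_le {n : ℕ} (N : ℕ) (f : SchwartzMap (Rn n) ℂ) (ξ : Rn n) {B : ℝ}
    (h0 : ‖iteratedFDeriv ℝ 0 f ξ‖ ≤ B) (hN : ‖iteratedFDeriv ℝ N f ξ‖ ≤ B)
    (o : Option (Fin n)) : ‖pureDerivs N f o ξ‖ ≤ B := by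
  cases o with
  | none => simpa [pureDerivs] using h0
  | some i =>
    rw [pureDerivs, SchwartzMap.iteratedLineDerivOp_eq_iteratedFDeriv]
    refine (ContinuousMultilinearMap.le_opNorm _ _).trans ?_
    simpa using hN

open FourierTransform in
lemma weight_mul_norm_osc_le_sum {n : ℕ} (N : ℕ) (f : SchwartzMap (Rn n) ℂ) (z : Rn n) :
    (1 + ‖z‖) ^ (N + 1) * ‖osc f z‖ ≤ (n + 1 : ℝ) ^ N *
      ∑ o, ‖𝓕 (pureDerivs (N + 1) f o) (-(2 * π)⁻¹ • z)‖ := by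
  simpa [Fintype.sum_option, pureDerivs] using weight_mul_norm_osc_le N f z

section CompactlyControlled

variable {n N : ℕ} {f : SchwartzMap (Rn n) ℂ} {A : ℝ} {S : Set (Rn n)}

lemma weight_mul_norm_osc_le_volume (hS : MeasurableSet S) (hfin : volume S ≠ ⊤)
    (h0 : ∀ ξ, ‖iteratedFDeriv ℝ 0 f ξ‖ ≤ S.indicator (fun _ => A) ξ)
    (hN : ∀ ξ, ‖iteratedFDeriv ℝ (N + 1) f ξ‖ ≤ S.indicator (fun _ => A) ξ) (z : Rn n) :
    (1 + ‖z‖) ^ (N + 1) * ‖osc f z‖ ≤ (n + 1 : ℝ) ^ (N + 1) * (A * volume.real S) := by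
  refine (weight_mul_norm_osc_le_sum N f z).trans ?_
  rw [pow_succ, mul_assoc]
  gcongr
  refine (Finset.sum_le_card_nsmul _ _ (A * volume.real S) fun o _ => ?_).trans ?_
  · exact SchwartzMap.norm_fourier_le_of_norm_le_indicator _ hS hfin
      (fun ξ => norm_pureDerivs_le _ f ξ (h0 ξ) (hN ξ) o) _
  · simp

open FourierTransform in
lemma lintegral_weight_mul_norm_osc_sq_le (hS : MeasurableSet S) (hfin : volume S ≠ ⊤)
    (h0 : ∀ ξ, ‖iteratedFDeriv ℝ 0 f ξ‖ ≤ S.indicator (fun _ => A) ξ)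
    (hN : ∀ ξ, ‖iteratedFDeriv ℝ (N + 1) f ξ‖ ≤ S.indicator (fun _ => A) ξ) :
    ∫⁻ z, ENNReal.ofReal (((1 + ‖z‖) ^ (N + 1) * ‖osc f z‖) ^ 2) ≤
      ENNReal.ofReal ((2 * π) ^ n * (n + 1 : ℝ) ^ (2 * N + 2) * (A ^ 2 * volume.real S)) := by
  have hm (o : Option (Fin n)) :
      Measurable fun w => ENNReal.ofReal (‖𝓕 (pureDerivs (N + 1) f o) w‖ ^ 2) :=
    ((𝓕 (pureDerivs (N + 1) f o)).continuous.norm.pow 2).measurable.ennreal_ofReal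
  calc ∫⁻ z, ENNReal.ofReal (((1 + ‖z‖) ^ (N + 1) * ‖osc f z‖) ^ 2)
      ≤ ∫⁻ z : Rn n, (fun w => ENNReal.ofReal ((n + 1 : ℝ) ^ (2 * N + 1)) *
          ∑ o, ENNReal.ofReal (‖𝓕 (pureDerivs (N + 1) f o) w‖ ^ 2)) (-(2 * π)⁻¹ • z) := by
        refine lintegral_mono fun z => ?_
        dsimp only
        rw [← ENNReal.ofReal_sum_of_nonneg (fun _ _ => by positivity),
          ← ENNReal.ofReal_mul (by positivity)]
        apply ENNReal.ofReal_le_ofReal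
        have h1 := weight_mul_norm_osc_le_sum N f z
        have h2 := sq_sum_le_card_mul_sum_sq (s := (Finset.univ : Finset (Option (Fin n))))
          (f := fun o => ‖𝓕 (pureDerivs (N + 1) f o) (-(2 * π)⁻¹ • z)‖)
        simp only [Finset.card_univ, Fintype.card_option, Fintype.card_fin] at h2
        push_cast at h2
        calc _ ≤ _ := pow_le_pow_left₀ (by positivity) h1 2
          _ ≤ _ := by
            rw [mul_pow, ← pow_mul, pow_succ _ (2 * N), mul_assoc, mul_comm N 2]
            gcongr
    _ = ENNReal.ofReal ((2 * π) ^ n) * (ENNReal.ofReal ((n + 1 : ℝ) ^ (2 * N + 1)) *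
          ∑ o, ∫⁻ w, ENNReal.ofReal (‖𝓕 (pureDerivs (N + 1) f o) w‖ ^ 2)) := by
        have hs := Finset.measurable_fun_sum Finset.univ fun o _ => hm o
        rw [lintegral_comp_neg_inv_two_pi_smul _ (hs.const_mul _), lintegral_const_mul _ hs,
          lintegral_finsetSum _ fun o _ => hm o]
    _ ≤ ENNReal.ofReal ((2 * π) ^ n) * (ENNReal.ofReal ((n + 1 : ℝ) ^ (2 * N + 1)) *
          ∑ _o : Option (Fin n), ENNReal.ofReal (A ^ 2 * volume.real S)) := by
        gcongr with o
        exact SchwartzMap.lintegral_fourier_sq_le _ hS hfin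
          fun ξ => norm_pureDerivs_le _ f ξ (h0 ξ) (hN ξ) o
    _ = _ := by
        rw [← ENNReal.ofReal_sum_of_nonneg (fun _ _ => by positivity),
          ← ENNReal.ofReal_mul (by positivity), ← ENNReal.ofReal_mul (by positivity)]
        congr 1
        simp
        ring

end CompactlyControlled

lemma contDiff_uncurry_iteratedFDeriv {n : ℕ} {a : Rn n → Rn n → ℂ}
    (ha : ContDiff ℝ (⊤ : ℕ∞) (Function.uncurry a)) (k : ℕ) :
    ContDiff ℝ (⊤ : ℕ∞) fun p : Rn n × Rn n => iteratedFDeriv ℝ k (a p.1) p.2 := by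
  induction k with
  | zero =>
    exact (continuousMultilinearCurryFin0 ℝ (Rn n) ℂ).symm.contDiff.comp ha
  | succ k ih =>
    have h : ContDiff ℝ (⊤ : ℕ∞)
        fun p : Rn n × Rn n => fderiv ℝ (iteratedFDeriv ℝ k (a p.1)) p.2 := by
      refine ContDiff.fderiv (f := fun p : Rn n × Rn n => iteratedFDeriv ℝ k (a p.1)) (m := (⊤ : ℕ∞))
        ?_ contDiff_snd (by simp)
      exact ih.comp (contDiff_fst.fst.prodMk contDiff_snd)
    exact (continuousMultilinearCurryLeftEquiv ℝ (fun _ : Fin (k + 1) => Rn n) ℂ).symm.contDiff.comp h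

lemma contDiff_right_of_uncurry {n : ℕ} {a : Rn n → Rn n → ℂ}
    (ha : ContDiff ℝ (⊤ : ℕ∞) (Function.uncurry a)) (x : Rn n) :
    ContDiff ℝ (⊤ : ℕ∞) (a x) :=
  ha.comp (contDiff_const.prodMk contDiff_id)

lemma norm_iteratedFDeriv_sub_le {n : ℕ} {a : Rn n → Rn n → ℂ}
    (ha : ContDiff ℝ (⊤ : ℕ∞) (Function.uncurry a)) {k : ℕ} {B : ℝ} {ξ : Rn n}
    (hB : ∀ x, ‖iteratedFDeriv ℝ 1 (fun y => iteratedFDeriv ℝ k (fun η => a y η) ξ) x‖ ≤ B)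
    (x x' : Rn n) :
    ‖iteratedFDeriv ℝ k (fun η => a x η - a x' η) ξ‖ ≤ B * ‖x - x'‖ := by
  have hk (y : Rn n) : ContDiffAt ℝ k (a y) ξ :=
    ((contDiff_right_of_uncurry ha y).of_le (mod_cast le_top)).contDiffAt
  rw [fun_iteratedFDeriv_sub_apply (hk x) (hk x')]
  have hd : Differentiable ℝ fun y => iteratedFDeriv ℝ k (a y) ξ :=
    ((contDiff_uncurry_iteratedFDeriv ha k).comp
      (contDiff_id.prodMk contDiff_const)).differentiable (by simp)
  refine Convex.norm_image_sub_le_of_norm_fderiv_le (𝕜 := ℝ) (s := Set.univ)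
    (fun y _ => hd y) (fun y _ => ?_) convex_univ (Set.mem_univ x') (Set.mem_univ x)
  rw [← norm_iteratedFDeriv_one]
  exact hB y

lemma LPcut.contDiff_ofReal {n : ℕ} {C₀ : ℝ} {ψ : Rn n → ℝ} (hψ : LPcut C₀ ψ) :
    ContDiff ℝ (⊤ : ℕ∞) fun ξ => (ψ ξ : ℂ) :=
  Complex.ofRealCLM.contDiff.comp hψ.1

lemma LPcut.exists_norm_iteratedFDeriv_le {n : ℕ} {C₀ : ℝ} {ψ : Rn n → ℝ} (hψ : LPcut C₀ ψ)
    (i : ℕ) : ∃ B : ℝ, 0 ≤ B ∧ ∀ ξ, ‖iteratedFDeriv ℝ i (fun ξ => (ψ ξ : ℂ)) ξ‖ ≤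
      {ξ : Rn n | C₀⁻¹ ≤ ‖ξ‖ ∧ ‖ξ‖ ≤ 2 * C₀}.indicator (fun _ => B) ξ := by
  have hc : HasCompactSupport fun ξ => (ψ ξ : ℂ) := hψ.2.1.comp_left (g := fun t : ℝ => (t : ℂ)) (by simp)
  obtain ⟨B, hB⟩ := (hc.iteratedFDeriv (𝕜 := ℝ) i).exists_bound_of_continuous
    (hψ.contDiff_ofReal.continuous_iteratedFDeriv (mod_cast le_top))
  refine ⟨B, (norm_nonneg _).trans (hB 0), fun ξ => ?_⟩
  by_cases hξ : ξ ∈ {ξ : Rn n | C₀⁻¹ ≤ ‖ξ‖ ∧ ‖ξ‖ ≤ 2 * C₀}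
  · simpa only [Set.indicator_of_mem hξ] using hB ξ
  · rw [Set.indicator_of_notMem hξ]
    have : ξ ∉ Function.support (iteratedFDeriv ℝ i fun ξ => (ψ ξ : ℂ)) := fun h =>
      hξ (hψ.2.2.2.2 (closure_mono (fun y hy => by simpa using hy)
        (support_iteratedFDeriv_subset i h)))
    simp [Function.notMem_support.1 this]

lemma one_add_sq_rpow_le {m C₀ s t : ℝ} (hm : m ≤ 0) (hC₀ : 0 < C₀) (ht : 0 < t)
    (hs : t * C₀⁻¹ ≤ s) : (1 + s ^ 2) ^ (m / 2) ≤ C₀ ^ (-m) * t ^ m := by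
  have h0 : 0 < t * C₀⁻¹ := by positivity
  calc (1 + s ^ 2) ^ (m / 2) ≤ ((t * C₀⁻¹) ^ 2) ^ (m / 2) := by
        refine Real.rpow_le_rpow_of_nonpos (by positivity) ?_ (by linarith)
        nlinarith
    _ = (t * C₀⁻¹) ^ m := by
        rw [← Real.rpow_natCast, ← Real.rpow_mul h0.le]
        congr 1
        push_cast
        ring
    _ = _ := by
        rw [Real.mul_rpow ht.le (by positivity), Real.inv_rpow hC₀.le, ← Real.rpow_neg hC₀.le,
          mul_comm]

lemma LPcut.exists_norm_iteratedFDeriv_mul_le {n : ℕ} {C₀ : ℝ} {ψ : Rn n → ℝ} (hC₀ : 1 < C₀)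
    (hψ : LPcut C₀ ψ) {m : ℝ} (hm : m ≤ 0) (k : ℕ) :
    ∃ C : ℝ, 0 ≤ C ∧ ∀ (j : ℕ) (M : ℝ) (g : Rn n → ℂ), 0 ≤ M → ContDiff ℝ (⊤ : ℕ∞) g →
      (∀ i ≤ k, ∀ ξ, ‖iteratedFDeriv ℝ i g ξ‖ ≤ M * (1 + ‖ξ‖ ^ 2) ^ (m / 2)) → ∀ ξ,
      ‖iteratedFDeriv ℝ k (fun ξ => g ξ * (ψ (((2 : ℝ) ^ j)⁻¹ • ξ) : ℂ)) ξ‖ ≤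
        (Metric.closedBall (0 : Rn n) (2 * C₀ * 2 ^ j)).indicator
          (fun _ => C * M * ((2 : ℝ) ^ j) ^ m) ξ := by
  choose B hB0 hB using hψ.exists_norm_iteratedFDeriv_le
  refine ⟨∑ i ∈ Finset.range (k + 1), (k.choose i : ℝ) * C₀ ^ (-m) * B (k - i),
    Finset.sum_nonneg fun i _ => by have := hB0 (k - i); positivity,
    fun j M g hM hg hgb ξ => ?_⟩
  have ht : (1 : ℝ) ≤ 2 ^ j := one_le_pow₀ (by norm_num)
  have hψj : ContDiff ℝ (⊤ : ℕ∞) fun ξ : Rn n => (ψ (((2 : ℝ) ^ j)⁻¹ • ξ) : ℂ) :=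
    hψ.contDiff_ofReal.comp (contDiff_const_smul _)
  have hD (i : ℕ) : ‖iteratedFDeriv ℝ i (fun ξ : Rn n => (ψ (((2 : ℝ) ^ j)⁻¹ • ξ) : ℂ)) ξ‖ ≤
      {ξ : Rn n | C₀⁻¹ ≤ ‖ξ‖ ∧ ‖ξ‖ ≤ 2 * C₀}.indicator (fun _ => B i) (((2 : ℝ) ^ j)⁻¹ • ξ) := by
    rw [iteratedFDeriv_comp_const_smul (f := fun ξ : Rn n => (ψ ξ : ℂ)) _
      (hψ.contDiff_ofReal.of_le (mod_cast le_top)), norm_smul]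
    refine (mul_le_of_le_one_left (norm_nonneg _) ?_).trans (hB i _)
    rw [norm_pow, norm_inv, Real.norm_of_nonneg (by positivity)]
    exact pow_le_one₀ (by positivity) (inv_le_one_of_one_le₀ ht)
  refine (norm_iteratedFDeriv_mul_le hg hψj ξ (mod_cast le_top)).trans ?_
  have hnorm : ‖((2 : ℝ) ^ j)⁻¹ • ξ‖ = ‖ξ‖ / 2 ^ j := by
    rw [norm_smul, norm_inv, Real.norm_of_nonneg (by positivity), inv_mul_eq_div]
  by_cases hξ : ((2 : ℝ) ^ j)⁻¹ • ξ ∈ {ξ : Rn n | C₀⁻¹ ≤ ‖ξ‖ ∧ ‖ξ‖ ≤ 2 * C₀}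
  · simp only [Set.indicator_of_mem hξ] at hD
    obtain ⟨h1, h2⟩ := hξ
    rw [hnorm, le_div_iff₀ (by positivity), mul_comm] at h1
    rw [hnorm, div_le_iff₀ (by positivity)] at h2
    rw [Set.indicator_of_mem (by simpa using h2), Finset.sum_mul, Finset.sum_mul]
    refine Finset.sum_le_sum fun i hi => ?_
    have h3 := one_add_sq_rpow_le hm (by linarith : 0 < C₀) (by positivity : (0 : ℝ) < 2 ^ j) h1
    calc _ ≤ (k.choose i : ℝ) * (M * (C₀ ^ (-m) * ((2 : ℝ) ^ j) ^ m)) * B (k - i) := by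
          gcongr
          · exact (hgb i (Nat.lt_succ_iff.1 (Finset.mem_range.1 hi)) ξ).trans (by gcongr)
          · exact hD _
      _ = _ := by ring
  · simp only [Set.indicator_of_notMem hξ] at hD
    refine (Finset.sum_nonpos fun i _ => ?_).trans (Set.indicator_nonneg (fun _ _ => ?_) _)
    · rw [le_antisymm (hD (k - i)) (norm_nonneg _), mul_zero]
    · have : 0 ≤ ∑ i ∈ Finset.range (k + 1), (k.choose i : ℝ) * C₀ ^ (-m) * B (k - i) :=
        Finset.sum_nonneg fun i _ => by have := hB0 (k - i); positivity
      positivity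

lemma hasCompactSupport_mul_cutoff {n : ℕ} {ψ : Rn n → ℝ} (hψ : HasCompactSupport ψ)
    (j : ℕ) (g : Rn n → ℂ) :
    HasCompactSupport fun ξ => g ξ * (ψ (((2 : ℝ) ^ j)⁻¹ • ξ) : ℂ) := by
  have h1 : HasCompactSupport fun ξ : Rn n => ψ (((2 : ℝ) ^ j)⁻¹ • ξ) :=
    hψ.comp_smul (by positivity)
  exact (h1.comp_left (g := fun t : ℝ => (t : ℂ)) (by simp)).mul_left

lemma contDiff_mul_cutoff {n : ℕ} {C₀ : ℝ} {ψ : Rn n → ℝ} (hψ : LPcut C₀ ψ)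
    (j : ℕ) {g : Rn n → ℂ} (hg : ContDiff ℝ (⊤ : ℕ∞) g) :
    ContDiff ℝ (⊤ : ℕ∞) fun ξ => g ξ * (ψ (((2 : ℝ) ^ j)⁻¹ • ξ) : ℂ) :=
  hg.mul (hψ.contDiff_ofReal.comp (contDiff_const_smul _))

lemma LPcut.exists_osc_bounds {n : ℕ} {C₀ : ℝ} {ψ : Rn n → ℝ} (hC₀ : 1 < C₀)
    (hψ : LPcut C₀ ψ) {m : ℝ} (hm : m ≤ 0) (N : ℕ) :
    ∃ C : ℝ, 0 ≤ C ∧ ∀ (j : ℕ) (M : ℝ) (g : Rn n → ℂ), 0 ≤ M → ContDiff ℝ (⊤ : ℕ∞) g →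
      (∀ i ≤ N + 1, ∀ ξ, ‖iteratedFDeriv ℝ i g ξ‖ ≤ M * (1 + ‖ξ‖ ^ 2) ^ (m / 2)) →
      (∀ z, (1 + ‖z‖) ^ (N + 1) * ‖osc (fun ξ => g ξ * (ψ (((2 : ℝ) ^ j)⁻¹ • ξ) : ℂ)) z‖ ≤
        C * M * ((2 : ℝ) ^ j) ^ (m + n)) ∧
      ∫⁻ z, ENNReal.ofReal (((1 + ‖z‖) ^ (N + 1) *
        ‖osc (fun ξ => g ξ * (ψ (((2 : ℝ) ^ j)⁻¹ • ξ) : ℂ)) z‖) ^ 2) ≤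
        ENNReal.ofReal (C * M ^ 2 * ((2 : ℝ) ^ j) ^ (2 * m + n)) := by
  obtain ⟨B₀, hB₀, h₀⟩ := hψ.exists_norm_iteratedFDeriv_mul_le hC₀ hm 0
  obtain ⟨B₁, hB₁, h₁⟩ := hψ.exists_norm_iteratedFDeriv_mul_le hC₀ hm (N + 1)
  set V := volume.real (Metric.closedBall (0 : Rn n) 1) with hV
  set D₁ := (n + 1 : ℝ) ^ (N + 1) * ((B₀ + B₁) * ((2 * C₀) ^ n * V)) with hD₁
  set D₂ := (2 * π) ^ n * (n + 1 : ℝ) ^ (2 * N + 2) * ((B₀ + B₁) ^ 2 * ((2 * C₀) ^ n * V)) with hD₂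
  have hC₀' : 0 < C₀ := by linarith
  have hV0 : 0 ≤ V := measureReal_nonneg
  have hD₁0 : 0 ≤ D₁ := by positivity
  have hD₂0 : 0 ≤ D₂ := by positivity
  refine ⟨D₁ + D₂, by positivity, fun j M g hM hg hgb => ?_⟩
  set b : Rn n → ℂ := fun ξ => g ξ * (ψ (((2 : ℝ) ^ j)⁻¹ • ξ) : ℂ) with hb
  set f : SchwartzMap (Rn n) ℂ :=
    (hasCompactSupport_mul_cutoff hψ.2.1 j g).toSchwartzMap (contDiff_mul_cutoff hψ j hg) with hf
  have hfb : ⇑f = b := rfl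
  set S := Metric.closedBall (0 : Rn n) (2 * C₀ * 2 ^ j) with hS
  set T : ℝ := 2 ^ j with hT
  have hT0 : 0 < T := by positivity
  have hvol : volume.real S = T ^ (n : ℝ) * ((2 * C₀) ^ n * V) := by
    rw [hS, Measure.real, Measure.addHaar_closedBall' _ _ (by positivity), finrank_euclideanSpace_fin,
      ENNReal.toReal_mul, ENNReal.toReal_ofReal (by positivity), ← Measure.real, ← hV, mul_pow,
      Real.rpow_natCast]
    ring
  have hind {c : ℝ} (hc : c ≤ B₀ + B₁) (ξ : Rn n) :
      S.indicator (fun _ => c * M * T ^ m) ξ ≤ S.indicator (fun _ => (B₀ + B₁) * M * T ^ m) ξ :=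
    Set.indicator_le_indicator (by gcongr)
  have hf0 (ξ : Rn n) : ‖iteratedFDeriv ℝ 0 f ξ‖ ≤
      S.indicator (fun _ => (B₀ + B₁) * M * T ^ m) ξ :=
    (h₀ j M g hM hg (fun i hi => hgb i (by omega)) ξ).trans (hind (by linarith) ξ)
  have hfN (ξ : Rn n) : ‖iteratedFDeriv ℝ (N + 1) f ξ‖ ≤
      S.indicator (fun _ => (B₀ + B₁) * M * T ^ m) ξ :=
    (h₁ j M g hM hg hgb ξ).trans (hind (by linarith) ξ)
  have hSm : MeasurableSet S := measurableSet_closedBall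
  have hSf : volume S ≠ ⊤ := measure_closedBall_lt_top.ne
  constructor
  · intro z
    have := weight_mul_norm_osc_le_volume hSm hSf hf0 hfN z
    rw [hfb] at this
    refine this.trans ?_
    calc _ = D₁ * M * T ^ (m + n) := by rw [hvol, Real.rpow_add hT0, hD₁]; ring
      _ ≤ _ := by gcongr; linarith
  · have := lintegral_weight_mul_norm_osc_sq_le hSm hSf hf0 hfN
    rw [hfb] at this
    refine this.trans (ENNReal.ofReal_le_ofReal ?_)
    calc _ = D₂ * M ^ 2 * T ^ (2 * m + n) := by
          rw [hvol, Real.rpow_add hT0, two_mul m, Real.rpow_add hT0, hD₂]; ring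
      _ ≤ _ := by gcongr; linarith

/-- The kernel of `T_j` in the variables `(x, x - y)`. -/
def localKernel {n : ℕ} (a : Rn n → Rn n → ℂ) (ψ : Rn n → ℝ) (j : ℕ) (x z : Rn n) : ℂ :=
  ((((2 * π) ^ n)⁻¹ : ℝ) : ℂ) * osc (fun ξ => a x ξ * (ψ (((2 : ℝ) ^ j)⁻¹ • ξ) : ℂ)) z

lemma Kj_eq_localKernel {n : ℕ} (a : Rn n → Rn n → ℂ) (ψ : Rn n → ℝ) (j : ℕ) (x y : Rn n) :
    Kj a ψ j x y = localKernel a ψ j x (x - y) := by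
  simp only [Kj, localKernel, osc, mul_assoc]

lemma norm_localKernel_le {n : ℕ} (a : Rn n → Rn n → ℂ) (ψ : Rn n → ℝ) (j : ℕ) (x z : Rn n) :
    ‖localKernel a ψ j x z‖ ≤ ‖osc (fun ξ => a x ξ * (ψ (((2 : ℝ) ^ j)⁻¹ • ξ) : ℂ)) z‖ := by
  rw [localKernel, norm_mul, Complex.norm_real, Real.norm_of_nonneg (by positivity)]
  refine mul_le_of_le_one_left (norm_nonneg _) (inv_le_one_of_one_le₀ (one_le_pow₀ ?_))
  linarith [Real.pi_gt_three]

lemma continuous_osc_integrand {n : ℕ} {b : Rn n → ℂ} (hb : Continuous b) (z : Rn n) :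
    Continuous fun ξ : Rn n => Complex.exp (Complex.I * ((⟪z, ξ⟫_ℝ : ℝ) : ℂ)) * b ξ := by
  fun_prop

lemma localKernel_sub {n : ℕ} {a : Rn n → Rn n → ℂ}
    (ha : ContDiff ℝ (⊤ : ℕ∞) (Function.uncurry a)) {C₀ : ℝ} {ψ : Rn n → ℝ} (hψ : LPcut C₀ ψ)
    (j : ℕ) (x x' z : Rn n) :
    localKernel a ψ j x z - localKernel a ψ j x' z =
      localKernel (fun _ ξ => a x ξ - a x' ξ) ψ j x z := by
  have hi (x : Rn n) : Integrable fun ξ : Rn n => Complex.exp (Complex.I * ((⟪z, ξ⟫_ℝ : ℝ) : ℂ)) *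
      (a x ξ * (ψ (((2 : ℝ) ^ j)⁻¹ • ξ) : ℂ)) :=
    (continuous_osc_integrand
      (contDiff_mul_cutoff hψ j (contDiff_right_of_uncurry ha x)).continuous z).integrable_of_hasCompactSupport
      (hasCompactSupport_mul_cutoff hψ.2.1 j (a x)).mul_left
  simp only [localKernel, osc, ← mul_sub]
  rw [← integral_sub (hi x) (hi x')]
  congr 2
  ext ξ
  ring

lemma continuous_localKernel {n : ℕ} {a : Rn n → Rn n → ℂ}
    (ha : ContDiff ℝ (⊤ : ℕ∞) (Function.uncurry a)) {C₀ : ℝ} {ψ : Rn n → ℝ} (hψ : LPcut C₀ ψ)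
    (j : ℕ) : Continuous fun p : Rn n × Rn n => localKernel a ψ j p.1 p.2 := by
  have hs : IsCompact (tsupport fun ξ : Rn n => ((1 : ℂ) * (ψ (((2 : ℝ) ^ j)⁻¹ • ξ) : ℂ))) :=
    hasCompactSupport_mul_cutoff hψ.2.1 j fun _ => 1
  have hc : Continuous (Function.uncurry fun (p : Rn n × Rn n) (ξ : Rn n) =>
      Complex.exp (Complex.I * ((⟪p.2, ξ⟫_ℝ : ℝ) : ℂ)) *
        (a p.1 ξ * (ψ (((2 : ℝ) ^ j)⁻¹ • ξ) : ℂ))) := by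
    have h1 : Continuous fun q : (Rn n × Rn n) × Rn n => a q.1.1 q.2 :=
      ha.continuous.comp (by fun_prop : Continuous fun q : (Rn n × Rn n) × Rn n => (q.1.1, q.2))
    have h2 : Continuous ψ := hψ.1.continuous
    simp only [Function.uncurry_def]
    fun_prop
  have h := continuous_parametric_integral_of_continuous (μ := volume) hc hs
  refine continuous_const.mul (h.congr fun p => ?_)
  refine setIntegral_eq_integral_of_forall_compl_eq_zero fun ξ hξ => ?_
  have := image_eq_zero_of_notMem_tsupport hξ
  rw [one_mul] at this
  rw [this, mul_zero, mul_zero]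

lemma HormClass.exists_localKernel_bounds {n : ℕ} (hn : 1 ≤ n) {δ : ℝ} (hδ1 : δ < 1)
    {a : Rn n → Rn n → ℂ} (ha : HormClass (-(n : ℝ)) 0 δ a) {C₀ : ℝ} (hC₀ : 1 < C₀)
    {ψ : Rn n → ℝ} (hψ : LPcut C₀ ψ) (N : ℕ) :
    ∃ C : ℝ, 0 ≤ C ∧ ∀ (j : ℕ) (x : Rn n),
      ∫⁻ z, ENNReal.ofReal (((1 + ‖z‖) ^ (N + 1) * ‖localKernel a ψ j x z‖) ^ 2) ≤
        ENNReal.ofReal (C * ((2 : ℝ) ^ j) ^ (-(n : ℝ))) ∧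
      ∀ x' z, (1 + ‖z‖) ^ (N + 1) * ‖localKernel a ψ j x z - localKernel a ψ j x' z‖ ≤
        C * ((2 : ℝ) ^ j) ^ δ * ‖x - x'‖ := by
  obtain ⟨hsm, hbd⟩ := ha
  choose B hB0 hB using hbd
  have hn' : (1 : ℝ) ≤ n := by exact_mod_cast hn
  obtain ⟨D₁, hD₁, h₁⟩ := hψ.exists_osc_bounds hC₀ (m := -(n : ℝ)) (by linarith) N
  obtain ⟨D₂, hD₂, h₂⟩ := hψ.exists_osc_bounds hC₀ (m := -(n : ℝ) + δ) (by linarith) N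
  set M₀ := ∑ i ∈ Finset.range (N + 2), B i 0 with hM₀
  set M₁ := ∑ i ∈ Finset.range (N + 2), B i 1 with hM₁
  have hM₀0 : 0 ≤ M₀ := Finset.sum_nonneg fun i _ => (hB0 i 0).le
  have hM₁0 : 0 ≤ M₁ := Finset.sum_nonneg fun i _ => (hB0 i 1).le
  have hle (l i : ℕ) (hi : i ≤ N + 1) : B i l ≤ ∑ i ∈ Finset.range (N + 2), B i l :=
    Finset.single_le_sum (f := fun i => B i l) (fun i _ => (hB0 i l).le)
      (Finset.mem_range.2 (by omega))
  refine ⟨D₁ * M₀ ^ 2 + D₂ * M₁, by positivity, fun j x => ⟨?_, fun x' z => ?_⟩⟩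
  · have := (h₁ j M₀ (a x) hM₀0 (contDiff_right_of_uncurry hsm x) fun i hi ξ => ?_).2
    · calc _ ≤ _ := lintegral_mono fun z => by
            apply ENNReal.ofReal_le_ofReal
            gcongr
            exact norm_localKernel_le a ψ j x z
        _ ≤ _ := this
        _ ≤ _ := by
          apply ENNReal.ofReal_le_ofReal
          rw [show 2 * -(n : ℝ) + n = -n by ring]
          gcongr
          exact le_add_of_nonneg_right (by positivity)
    · have := hB i 0 x ξ
      rw [norm_iteratedFDeriv_zero] at this
      refine this.trans ?_
      simp only [zero_mul, Nat.cast_zero, mul_zero, sub_zero, add_zero]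
      gcongr
      exact hle 0 i hi
  · rw [localKernel_sub hsm hψ]
    have := (h₂ j (M₁ * ‖x - x'‖) (fun ξ => a x ξ - a x' ξ) (by positivity)
      ((contDiff_right_of_uncurry hsm x).sub (contDiff_right_of_uncurry hsm x'))
      fun i hi ξ => ?_).1 z
    · calc _ ≤ _ := mul_le_mul_of_nonneg_left
            (norm_localKernel_le (fun _ ξ => a x ξ - a x' ξ) ψ j x z) (by positivity)
        _ ≤ _ := this
        _ = D₂ * M₁ * ((2 : ℝ) ^ j) ^ δ * ‖x - x'‖ := by
          rw [show -(n : ℝ) + δ + n = δ by ring]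
          ring
        _ ≤ _ := by
          gcongr
          exact le_add_of_nonneg_left (by positivity)
    · refine (norm_iteratedFDeriv_sub_le hsm (fun y => hB i 1 y ξ) x x').trans ?_
      simp only [zero_mul, Nat.cast_one, mul_one, sub_zero]
      rw [mul_right_comm]
      gcongr
      exact hle 1 i hi

lemma cube_eq_preimage {n : ℕ} (x₀ : Rn n) (l : ℝ) :
    cube x₀ l = WithLp.ofLp ⁻¹' Set.Icc (fun i => x₀ i - l / 2) (fun i => x₀ i + l / 2) := by
  ext y
  simp only [cube, Set.mem_ofPred_eq, Set.mem_preimage, Set.mem_Icc, Pi.le_def, abs_le,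
    ← forall_and]
  refine forall_congr' fun i => ⟨fun h => ⟨?_, ?_⟩, fun h => ⟨?_, ?_⟩⟩ <;> linarith [h.1, h.2]

lemma measurableSet_cube {n : ℕ} (x₀ : Rn n) (l : ℝ) : MeasurableSet (cube x₀ l) := by
  rw [cube_eq_preimage]
  exact (PiLp.volume_preserving_ofLp (Fin n)).measurable measurableSet_Icc

lemma volume_cube {n : ℕ} (x₀ : Rn n) {l : ℝ} (hl : 0 ≤ l) :
    volume (cube x₀ l) = ENNReal.ofReal (l ^ n) := by
  rw [cube_eq_preimage, (PiLp.volume_preserving_ofLp (Fin n)).measure_preimage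
    measurableSet_Icc.nullMeasurableSet, Real.volume_Icc_pi, ENNReal.ofReal_pow hl]
  simp

lemma norm_sub_le_of_mem_cube {n : ℕ} {x₀ y : Rn n} {l : ℝ} (hy : y ∈ cube x₀ l) :
    ‖y - x₀‖ ≤ n * (l / 2) := by
  refine (EuclideanSpace.norm_le_sum_abs _).trans ?_
  refine (Finset.sum_le_card_nsmul _ _ (l / 2) fun i _ => hy i).trans ?_
  simp

lemma mem_cube_of_norm_sub_le {n : ℕ} {x₀ y : Rn n} {l : ℝ} (hy : ‖y - x₀‖ ≤ l / 2) :
    y ∈ cube x₀ l := fun i => by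
  simpa using (PiLp.norm_apply_le (y - x₀) i).trans hy

lemma add_mem_cube {n : ℕ} {x₀ x h : Rn n} {l r : ℝ} (hx : x ∈ cube x₀ l) (hh : h ∈ cube 0 r)
    (hr : r ≤ l) : x + h ∈ cube x₀ (2 * l) := fun i => by
  have h1 := hx i
  have h2 := hh i
  simp only [PiLp.add_apply, PiLp.zero_apply, sub_zero, abs_le] at h1 h2 ⊢
  constructor <;> linarith [h1.1, h1.2, h2.1, h2.2]

lemma ofReal_le_ofReal_sq_div_add {g t : ℝ} (ht : 0 < t) :
    ENNReal.ofReal g ≤ ENNReal.ofReal (g ^ 2 / t) + ENNReal.ofReal t := by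
  rw [← ENNReal.ofReal_add (by positivity) ht.le]
  apply ENNReal.ofReal_le_ofReal
  rw [← sub_nonneg]
  have : g ^ 2 / t + t - g = ((g - t / 2) ^ 2 + 3 / 4 * t ^ 2) / t := by
    field_simp
    ring
  rw [this]
  positivity

section FrozenKernel

variable {n P : ℕ} {k : Rn n → Rn n → ℂ} {A E l r t : ℝ}

lemma lintegral_cube_comp_sub_le (hk : Continuous fun p : Rn n × Rn n => k p.1 p.2)
    (hE : ∀ x, ∫⁻ z, ENNReal.ofReal (((1 + ‖z‖) ^ P * ‖k x z‖) ^ 2) ≤ ENNReal.ofReal E)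
    (V : ℝ) (ht : 0 < t) (hr : 0 < r) (w y : Rn n) :
    ∫⁻ h in cube 0 r, ENNReal.ofReal (V * ((1 + ‖w - h - y‖) ^ P * ‖k w (w - h - y)‖)) ≤
      ENNReal.ofReal (V ^ 2 / t) * ENNReal.ofReal E + ENNReal.ofReal (t * r ^ n) := by
  have hkw : Continuous (k w) := hk.comp (by fun_prop : Continuous fun z : Rn n => (w, z))
  have hm : Measurable fun z => ENNReal.ofReal (((1 + ‖z‖) ^ P * ‖k w z‖) ^ 2) := by
    have : Continuous fun z => ((1 + ‖z‖) ^ P * ‖k w z‖) ^ 2 := by fun_prop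
    exact this.measurable.ennreal_ofReal
  calc _ ≤ ∫⁻ h in cube 0 r, (ENNReal.ofReal (V ^ 2 / t) *
          ENNReal.ofReal (((1 + ‖w - h - y‖) ^ P * ‖k w (w - h - y)‖) ^ 2) +
          ENNReal.ofReal t) := by
        refine lintegral_mono fun h => (ofReal_le_ofReal_sq_div_add ht).trans_eq ?_
        rw [← ENNReal.ofReal_mul (by positivity)]
        congr 2
        ring
    _ = (∫⁻ h in cube 0 r, ENNReal.ofReal (V ^ 2 / t) *
          ENNReal.ofReal (((1 + ‖w - h - y‖) ^ P * ‖k w (w - h - y)‖) ^ 2)) +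
          ENNReal.ofReal (t * r ^ n) := by
        rw [lintegral_add_right _ measurable_const, setLIntegral_const, volume_cube _ hr.le,
          ENNReal.ofReal_mul ht.le]
    _ ≤ (∫⁻ h, ENNReal.ofReal (V ^ 2 / t) *
          ENNReal.ofReal (((1 + ‖w - h - y‖) ^ P * ‖k w (w - h - y)‖) ^ 2)) +
          ENNReal.ofReal (t * r ^ n) := by
        gcongr
        exact Measure.restrict_le_self
    _ ≤ _ := by
        rw [lintegral_const_mul' _ _ ENNReal.ofReal_ne_top]
        gcongr
        refine le_trans (le_of_eq ?_) (hE w)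
        have := lintegral_sub_left_eq_self (μ := (volume : Measure (Rn n)))
          (fun z => ENNReal.ofReal (((1 + ‖z‖) ^ P * ‖k w z‖) ^ 2)) (w - y)
        rw [← this]
        simp only [sub_right_comm]

lemma weight_le_mul_weight (hl : l ≤ 1) (hrl : r ≤ l) {x₀ w h y : Rn n}
    (hw : w ∈ cube x₀ (2 * l)) (hh : h ∈ cube 0 r) :
    (1 + ‖y - x₀‖) ^ P ≤ (1 + 2 * n : ℝ) ^ P * (1 + ‖w - h - y‖) ^ P := by
  rw [← mul_pow]
  have h1 := norm_sub_le_of_mem_cube hw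
  have h2 := norm_sub_le_of_mem_cube hh
  rw [sub_zero] at h2
  have h3 : ‖y - x₀‖ ≤ ‖w - h - y‖ + ‖w - x₀‖ + ‖h‖ := by
    have : y - x₀ = -(w - h - y) + (w - x₀) - h := by abel
    rw [this]
    refine (norm_sub_le _ _).trans ?_
    gcongr
    exact (norm_add_le _ _).trans (by rw [norm_neg])
  have hn : (0 : ℝ) ≤ n := Nat.cast_nonneg n
  have h4 : n * (2 * l / 2) ≤ (n : ℝ) := by nlinarith
  have h5 : n * (r / 2) ≤ (n : ℝ) := by nlinarith
  gcongr
  nlinarith [norm_nonneg (w - h - y)]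

lemma weight_mul_norm_kernel_le (hA0 : 0 ≤ A)
    (hA : ∀ x x' z, (1 + ‖z‖) ^ P * ‖k x z - k x' z‖ ≤ A * ‖x - x'‖)
    (hr : 0 < r) (hrl : r ≤ l) (hl : l ≤ 1) {x₀ x : Rn n} (y : Rn n) (hx : x ∈ cube x₀ l) :
    ENNReal.ofReal (r ^ n) * ENNReal.ofReal ((1 + ‖y - x₀‖) ^ P * ‖k x (x - y)‖) ≤
      (∫⁻ h in cube 0 r, ENNReal.ofReal
        ((1 + 2 * n : ℝ) ^ P * ((1 + ‖x - y‖) ^ P * ‖k (x + h) (x - y)‖))) +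
        ENNReal.ofReal ((1 + 2 * n : ℝ) ^ P * (A * (n * r))) * ENNReal.ofReal (r ^ n) := by
  set V : ℝ := (1 + 2 * n : ℝ) ^ P
  have hV0 : 0 ≤ V := by positivity
  rw [← volume_cube (0 : Rn n) hr.le, mul_comm, ← setLIntegral_const, ← setLIntegral_const,
    ← lintegral_add_right _ measurable_const]
  refine setLIntegral_mono' (measurableSet_cube _ _) fun h hh => ?_
  rw [← ENNReal.ofReal_add (by positivity) (by positivity)]
  apply ENNReal.ofReal_le_ofReal
  have h1 : (1 + ‖y - x₀‖) ^ P ≤ V * (1 + ‖x - y‖) ^ P := by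
    have := weight_le_mul_weight (P := P) (y := y) hl hrl (add_mem_cube hx hh hrl) hh
    simpa using this
  have h2 := hA x (x + h) (x - y)
  have h3 := norm_sub_le_of_mem_cube hh
  have h4 : ‖x - (x + h)‖ ≤ n * r := by
    rw [sub_add_cancel_left, norm_neg, ← sub_zero h]
    refine h3.trans ?_
    gcongr
    linarith
  have h5 : ‖k x (x - y)‖ ≤ ‖k (x + h) (x - y)‖ + ‖k x (x - y) - k (x + h) (x - y)‖ := by
    simpa using norm_add_le (k (x + h) (x - y)) (k x (x - y) - k (x + h) (x - y))
  calc (1 + ‖y - x₀‖) ^ P * ‖k x (x - y)‖ ≤ V * (1 + ‖x - y‖) ^ P *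
        (‖k (x + h) (x - y)‖ + ‖k x (x - y) - k (x + h) (x - y)‖) := by gcongr
    _ = V * ((1 + ‖x - y‖) ^ P * ‖k (x + h) (x - y)‖) +
        V * ((1 + ‖x - y‖) ^ P * ‖k x (x - y) - k (x + h) (x - y)‖) := by ring
    _ ≤ _ := add_le_add le_rfl (mul_le_mul_of_nonneg_left (h2.trans (by gcongr)) hV0)

lemma lintegral_cube_add_le (hrl : r ≤ l) {G : Rn n → Rn n → ℝ≥0∞} {x₀ h : Rn n}
    (hh : h ∈ cube 0 r) (y : Rn n) :
    ∫⁻ x in cube x₀ l, G (x + h) (x - y) ≤ ∫⁻ w in cube x₀ (2 * l), G w (w - h - y) := by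
  rw [← lintegral_indicator (measurableSet_cube _ _), ← lintegral_indicator (measurableSet_cube _ _),
    ← lintegral_add_right_eq_self ((cube x₀ (2 * l)).indicator fun w => G w (w - h - y)) h]
  refine lintegral_mono fun x => ?_
  by_cases hx : x ∈ cube x₀ l
  · rw [Set.indicator_of_mem hx, Set.indicator_of_mem (add_mem_cube hx hh hrl), add_sub_cancel_right]
  · rw [Set.indicator_of_notMem hx]
    exact zero_le

lemma lintegral_lintegral_cube_le (hrl : r ≤ l) {G : Rn n → Rn n → ℝ≥0∞}
    (hG : Measurable fun p : Rn n × Rn n => G p.1 p.2) (x₀ y : Rn n) :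
    ∫⁻ x in cube x₀ l, ∫⁻ h in cube 0 r, G (x + h) (x - y) ≤
      ∫⁻ w in cube x₀ (2 * l), ∫⁻ h in cube 0 r, G w (w - h - y) := by
  have h₁ : Measurable fun p : Rn n × Rn n => G (p.1 + p.2) (p.1 - y) :=
    hG.comp (by fun_prop : Measurable fun p : Rn n × Rn n => (p.1 + p.2, p.1 - y))
  have h₂ : Measurable fun p : Rn n × Rn n => G p.1 (p.1 - p.2 - y) :=
    hG.comp (by fun_prop : Measurable fun p : Rn n × Rn n => (p.1, p.1 - p.2 - y))
  calc _ = ∫⁻ h in cube 0 r, ∫⁻ x in cube x₀ l, G (x + h) (x - y) :=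
        lintegral_lintegral_swap h₁.aemeasurable
    _ ≤ ∫⁻ h in cube 0 r, ∫⁻ w in cube x₀ (2 * l), G w (w - h - y) :=
        setLIntegral_mono' (measurableSet_cube _ _) fun h hh => lintegral_cube_add_le hrl hh y
    _ = _ := (lintegral_lintegral_swap h₂.aemeasurable).symm

lemma lintegral_cube_kernel_le (hk : Continuous fun p : Rn n × Rn n => k p.1 p.2)
    (hE : ∀ x, ∫⁻ z, ENNReal.ofReal (((1 + ‖z‖) ^ P * ‖k x z‖) ^ 2) ≤ ENNReal.ofReal E)
    (hA0 : 0 ≤ A) (hA : ∀ x x' z, (1 + ‖z‖) ^ P * ‖k x z - k x' z‖ ≤ A * ‖x - x'‖)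
    (ht : 0 < t) (hr : 0 < r) (hrl : r ≤ l) (hl : l ≤ 1) (x₀ y : Rn n) :
    ENNReal.ofReal (r ^ n) *
        ∫⁻ x in cube x₀ l, ENNReal.ofReal ((1 + ‖y - x₀‖) ^ P * ‖k x (x - y)‖) ≤
      ENNReal.ofReal ((2 * l) ^ n) * (ENNReal.ofReal (((1 + 2 * n : ℝ) ^ P) ^ 2 / t) *
        ENNReal.ofReal E + ENNReal.ofReal (t * r ^ n)) +
      ENNReal.ofReal (l ^ n) * (ENNReal.ofReal ((1 + 2 * n : ℝ) ^ P * (A * (n * r))) *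
        ENNReal.ofReal (r ^ n)) := by
  set V : ℝ := (1 + 2 * n : ℝ) ^ P with hV
  have hV0 : 0 ≤ V := by positivity
  have hl0 : 0 < l := hr.trans_le hrl
  set G : Rn n → Rn n → ℝ≥0∞ := fun w z => ENNReal.ofReal (V * ((1 + ‖z‖) ^ P * ‖k w z‖)) with hG
  have hGm : Measurable fun p : Rn n × Rn n => G p.1 p.2 := by
    have : Continuous fun p : Rn n × Rn n => V * ((1 + ‖p.2‖) ^ P * ‖k p.1 p.2‖) := by fun_prop
    exact this.measurable.ennreal_ofReal
  calc _ = ∫⁻ x in cube x₀ l,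
          ENNReal.ofReal (r ^ n) * ENNReal.ofReal ((1 + ‖y - x₀‖) ^ P * ‖k x (x - y)‖) := by
        rw [lintegral_const_mul' _ _ ENNReal.ofReal_ne_top]
    _ ≤ ∫⁻ x in cube x₀ l, ((∫⁻ h in cube 0 r, G (x + h) (x - y)) +
          ENNReal.ofReal (V * (A * (n * r))) * ENNReal.ofReal (r ^ n)) :=
        setLIntegral_mono' (measurableSet_cube _ _) fun x hx =>
          weight_mul_norm_kernel_le hA0 hA hr hrl hl y hx
    _ = (∫⁻ x in cube x₀ l, ∫⁻ h in cube 0 r, G (x + h) (x - y)) +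
          ENNReal.ofReal (l ^ n) * (ENNReal.ofReal (V * (A * (n * r))) * ENNReal.ofReal (r ^ n)) := by
        rw [lintegral_add_right _ measurable_const, setLIntegral_const, volume_cube _ hl0.le,
          mul_comm (ENNReal.ofReal (l ^ n))]
    _ ≤ _ := by
        gcongr
        calc _ ≤ ∫⁻ w in cube x₀ (2 * l), ∫⁻ h in cube 0 r, G w (w - h - y) :=
              lintegral_lintegral_cube_le hrl hGm x₀ y
          _ ≤ ∫⁻ _w in cube x₀ (2 * l), (ENNReal.ofReal (V ^ 2 / t) *
                ENNReal.ofReal E + ENNReal.ofReal (t * r ^ n)) :=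
              lintegral_mono fun w => lintegral_cube_comp_sub_le hk hE V ht hr w y
          _ = _ := by
              rw [setLIntegral_const, volume_cube _ (by positivity), mul_comm]

end FrozenKernel

lemma HormClass.exists_lintegral_Kj_le {n : ℕ} (hn : 1 ≤ n) {δ : ℝ} (hδ1 : δ < 1)
    {a : Rn n → Rn n → ℂ} (ha : HormClass (-(n : ℝ)) 0 δ a) {C₀ : ℝ} (hC₀ : 1 < C₀)
    {ψ : Rn n → ℝ} (hψ : LPcut C₀ ψ) {lam : ℝ} (hlam : 1 ≤ lam) :
    ∃ K : ℝ, 0 < K ∧ ∀ l : ℝ, 0 < l → l < 1 → ∀ (j : ℕ) (x₀ y : Rn n),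
      ∫⁻ x in cube x₀ l, ‖Kj a ψ j x y‖ₑ ≤
        ENNReal.ofReal (l ^ n * (K * ((2 : ℝ) ^ ((j : ℝ) * δ) * l ^ lam +
          l ^ (-((n : ℝ) * lam) / 2) * (2 : ℝ) ^ (-((j : ℝ) * n) / 2)))) *
        (ENNReal.ofReal ((1 + ‖y - x₀‖) ^ (n + 1)))⁻¹ := by
  obtain ⟨C, hC, hbd⟩ := ha.exists_localKernel_bounds hn hδ1 hC₀ hψ n
  set V : ℝ := (1 + 2 * n : ℝ) ^ (n + 1) with hV
  refine ⟨2 ^ n * (V ^ 2 * C + 1) + V * C * n, by positivity, fun l hl hl1 j x₀ y => ?_⟩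
  set T : ℝ := 2 ^ j with hT
  set r : ℝ := l ^ lam with hr
  have hT0 : 0 < T := by positivity
  have hr0 : 0 < r := by positivity
  have hrl : r ≤ l := by
    simpa using Real.rpow_le_rpow_of_exponent_ge hl hl1.le hlam
  have hpow (s : ℝ) : (2 : ℝ) ^ ((j : ℝ) * s) = T ^ s := by
    rw [Real.rpow_mul (by norm_num), Real.rpow_natCast]
  set t : ℝ := l ^ (-((n : ℝ) * lam) / 2) * (2 : ℝ) ^ (-((j : ℝ) * n) / 2) with ht
  have ht0 : 0 < t := by positivity
  have hTt : T ^ (-(n : ℝ)) = t ^ 2 * r ^ n := by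
    rw [← hpow, ht, hr, mul_pow, ← Real.rpow_natCast, ← Real.rpow_natCast, ← Real.rpow_natCast,
      ← Real.rpow_mul hl.le, ← Real.rpow_mul hl.le, ← Real.rpow_mul (by norm_num),
      mul_right_comm, ← Real.rpow_add hl]
    have h1 : -((n : ℝ) * lam) / 2 * (2 : ℕ) + lam * n = 0 := by push_cast; ring
    have h2 : -((j : ℝ) * n) / 2 * (2 : ℕ) = j * -(n : ℝ) := by push_cast; ring
    rw [h1, h2, Real.rpow_zero, one_mul]
  have hsm : Continuous fun p : Rn n × Rn n => localKernel a ψ j p.1 p.2 :=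
    continuous_localKernel ha.1 hψ j
  have hmain := lintegral_cube_kernel_le (P := n + 1) hsm (fun x => (hbd j x).1)
    (by positivity : 0 ≤ C * T ^ δ) (fun x x' z => (hbd j x).2 x' z) ht0 hr0 hrl hl1.le x₀ y
  have hκ : 0 < (1 + ‖y - x₀‖) ^ (n + 1) := by positivity
  simp only [ENNReal.ofReal_mul hκ.le, ofReal_norm] at hmain
  rw [lintegral_const_mul' _ _ ENNReal.ofReal_ne_top, ← hV] at hmain
  rw [← ENNReal.div_eq_inv_mul.trans (mul_comm _ _),
    ENNReal.le_div_iff_mul_le (.inl (by simpa using hκ)) (.inl ENNReal.ofReal_ne_top), hpow]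
  simp only [Kj_eq_localKernel]
  have hrn : ENNReal.ofReal (r ^ n) ≠ 0 := by simpa using pow_pos hr0 n
  rw [← ENNReal.mul_le_mul_iff_right hrn ENNReal.ofReal_ne_top, mul_comm (lintegral _ _)]
  refine hmain.trans ?_
  rw [← ENNReal.ofReal_mul (by positivity), ← ENNReal.ofReal_mul (by positivity),
    ← ENNReal.ofReal_add (by positivity) (by positivity), ← ENNReal.ofReal_mul (by positivity),
    ← ENNReal.ofReal_mul (by positivity), ← ENNReal.ofReal_mul (by positivity),
    ← ENNReal.ofReal_add (by positivity) (by positivity)]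
  apply ENNReal.ofReal_le_ofReal
  rw [hTt]
  have hTδ : 0 ≤ T ^ δ * r := by positivity
  calc _ = l ^ n * r ^ n * (2 ^ n * (V ^ 2 * C + 1) * t + V * C * n * (T ^ δ * r)) := by
        rw [mul_pow]
        field_simp
    _ ≤ l ^ n * r ^ n * (2 ^ n * (V ^ 2 * C + 1) * (T ^ δ * r + t) +
          V * C * n * (T ^ δ * r + t)) := by
        gcongr
        · linarith
        · linarith
    _ = _ := by ring

lemma lintegral_cube_enorm_le_mHL {n : ℕ} (u : Rn n → ℂ) (x₀ : Rn n) {L : ℝ} (hL : 0 < L) :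
    ∫⁻ y in cube x₀ L, ‖u y‖ₑ ≤ ENNReal.ofReal (L ^ n) * mHL u x₀ := by
  have h0 : ENNReal.ofReal (L ^ n) ≠ 0 := by simpa using pow_pos hL n
  rw [mul_comm, ← ENNReal.div_le_iff h0 ENNReal.ofReal_ne_top]
  have hx : x₀ ∈ cube x₀ L := mem_cube_of_norm_sub_le (by simp; linarith)
  exact le_iSup_of_le x₀ (le_iSup_of_le L (le_iSup_of_le hL (le_iSup_of_le hx le_rfl)))

lemma inv_weight_le_tsum_indicator {n : ℕ} (x₀ y : Rn n) :
    (ENNReal.ofReal ((1 + ‖y - x₀‖) ^ (n + 1)))⁻¹ ≤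
      ∑' k : ℕ, ENNReal.ofReal (((2 : ℝ) ^ k) ^ (n + 1))⁻¹ *
        (cube x₀ (4 * 2 ^ k)).indicator 1 y := by
  obtain ⟨k, hk1, hk2⟩ := exists_nat_pow_near (by simp : 1 ≤ 1 + ‖y - x₀‖) one_lt_two
  refine le_trans ?_ (ENNReal.le_tsum k)
  have hy : y ∈ cube x₀ (4 * 2 ^ k) := mem_cube_of_norm_sub_le (by rw [pow_succ] at hk2; linarith)
  rw [Set.indicator_of_mem hy, Pi.one_apply, mul_one, ENNReal.ofReal_inv_of_pos (by positivity)]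
  gcongr

lemma lintegral_enorm_mul_inv_weight_le {n : ℕ} {u : Rn n → ℂ} (hu : Continuous u) (x₀ : Rn n) :
    ∫⁻ y, ‖u y‖ₑ * (ENNReal.ofReal ((1 + ‖y - x₀‖) ^ (n + 1)))⁻¹ ≤
      ENNReal.ofReal (4 ^ n * 2) * mHL u x₀ := by
  have hm (k : ℕ) : Measurable fun y => ‖u y‖ₑ *
      (ENNReal.ofReal (((2 : ℝ) ^ k) ^ (n + 1))⁻¹ * (cube x₀ (4 * 2 ^ k)).indicator 1 y) :=
    hu.enorm.measurable.mul ((measurable_one.indicator (measurableSet_cube _ _)).const_mul _)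
  calc _ ≤ ∫⁻ y, ∑' k : ℕ, ‖u y‖ₑ * (ENNReal.ofReal (((2 : ℝ) ^ k) ^ (n + 1))⁻¹ *
          (cube x₀ (4 * 2 ^ k)).indicator 1 y) := by
        refine lintegral_mono fun y => ?_
        rw [ENNReal.tsum_mul_left]
        gcongr
        exact inv_weight_le_tsum_indicator x₀ y
    _ = ∑' k : ℕ, ENNReal.ofReal (((2 : ℝ) ^ k) ^ (n + 1))⁻¹ *
          ∫⁻ y in cube x₀ (4 * 2 ^ k), ‖u y‖ₑ := by
        rw [lintegral_tsum fun k => (hm k).aemeasurable]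
        congr 1
        ext k
        rw [← lintegral_indicator (measurableSet_cube _ _),
          ← lintegral_const_mul' _ _ ENNReal.ofReal_ne_top]
        congr 1
        ext y
        by_cases hy : y ∈ cube x₀ (4 * 2 ^ k)
        · rw [Set.indicator_of_mem hy, Set.indicator_of_mem hy, Pi.one_apply, mul_one, mul_comm]
        · simp only [Set.indicator_of_notMem hy, mul_zero]
    _ ≤ ∑' k : ℕ, ENNReal.ofReal (4 ^ n * (1 / 2) ^ k) * mHL u x₀ := by
        refine ENNReal.tsum_le_tsum fun k => ?_
        calc _ ≤ ENNReal.ofReal (((2 : ℝ) ^ k) ^ (n + 1))⁻¹ *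
              (ENNReal.ofReal ((4 * 2 ^ k) ^ n) * mHL u x₀) := by
              gcongr
              exact lintegral_cube_enorm_le_mHL u x₀ (by positivity)
          _ = _ := by
              rw [← mul_assoc, ← ENNReal.ofReal_mul (by positivity)]
              congr 2
              rw [mul_pow, pow_succ, one_div, inv_pow]
              field_simp
    _ = _ := by
        rw [ENNReal.tsum_mul_right, ← ENNReal.ofReal_tsum_of_nonneg (fun k => by positivity)
          (summable_geometric_two.mul_left _), tsum_mul_left, tsum_geometric_two]

/-- If `a ∈ S^{-n}_{0,δ}` with `0 < δ < 1` and `λ ≥ 1`, then for `0 < l < 1`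
and `j ≥ 1` with `2^j ≥ l⁻¹`:
`|Q(x₀,l)|⁻¹ ∫_{Q(x₀,l)} |T_j u| dx ≤ C (2^{jδ} l^λ + l^{-nλ/2} 2^{-jn/2}) Mu(x₀)`. -/
theorem stmt12 (n : ℕ) (hn : 1 ≤ n) (δ : ℝ) (hδ0 : 0 < δ) (hδ1 : δ < 1)
    (a : Rn n → Rn n → ℂ) (ha : HormClass (-(n : ℝ)) 0 δ a)
    (lam : ℝ) (hlam : 1 ≤ lam)
    (C₀ : ℝ) (hC₀ : 1 < C₀) (ψ : Rn n → ℝ) (hψ : LPcut C₀ ψ) :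
    ∃ C : ℝ, 0 < C ∧ ∀ l : ℝ, 0 < l → l < 1 → ∀ j : ℕ, 1 ≤ j → l⁻¹ ≤ (2 : ℝ) ^ j →
      ∀ x₀ : Rn n, ∀ u : SchwartzMap (Rn n) ℂ,
        (∫⁻ x in cube x₀ l, (‖Tj a ψ j (⇑u) x‖₊ : ℝ≥0∞)) / ENNReal.ofReal (l ^ n) ≤
          ENNReal.ofReal (C * ((2 : ℝ) ^ ((j : ℝ) * δ) * l ^ lam +
            l ^ (-((n : ℝ) * lam) / 2) * (2 : ℝ) ^ (-((j : ℝ) * n) / 2))) *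
            mHL (⇑u) x₀ := by
  obtain ⟨K, hK, hKj⟩ := ha.exists_lintegral_Kj_le hn hδ1 hC₀ hψ hlam
  refine ⟨K * (4 ^ n * 2), by positivity, fun l hl hl1 j _ _ x₀ u => ?_⟩
  set Y : ℝ := (2 : ℝ) ^ ((j : ℝ) * δ) * l ^ lam +
    l ^ (-((n : ℝ) * lam) / 2) * (2 : ℝ) ^ (-((j : ℝ) * n) / 2) with hY
  have hY0 : 0 ≤ Y := by positivity
  have hl0 : ENNReal.ofReal (l ^ n) ≠ 0 := by simpa using pow_pos hl n
  rw [ENNReal.div_le_iff hl0 ENNReal.ofReal_ne_top]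
  have hm : Measurable fun p : Rn n × Rn n => ‖Kj a ψ j p.1 p.2‖ₑ * ‖u p.2‖ₑ := by
    simp only [Kj_eq_localKernel]
    have h1 := (continuous_localKernel ha.1 hψ j).comp
      (by fun_prop : Continuous fun p : Rn n × Rn n => (p.1, p.1 - p.2))
    exact h1.enorm.measurable.mul (u.continuous.comp continuous_snd).enorm.measurable
  calc _ ≤ ∫⁻ x in cube x₀ l, ∫⁻ y, ‖Kj a ψ j x y‖ₑ * ‖u y‖ₑ := by
        refine lintegral_mono fun x => (enorm_integral_le_lintegral_enorm _).trans_eq ?_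
        simp only [enorm_mul]
    _ = ∫⁻ y, ‖u y‖ₑ * ∫⁻ x in cube x₀ l, ‖Kj a ψ j x y‖ₑ := by
        rw [lintegral_lintegral_swap hm.aemeasurable]
        congr 1
        ext y
        rw [lintegral_mul_const' _ _ enorm_ne_top, mul_comm]
    _ ≤ ∫⁻ y, ENNReal.ofReal (l ^ n * (K * Y)) *
          (‖u y‖ₑ * (ENNReal.ofReal ((1 + ‖y - x₀‖) ^ (n + 1)))⁻¹) := by
        refine lintegral_mono fun y => ?_
        rw [mul_left_comm]
        gcongr
        exact hKj l hl hl1 j x₀ y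
    _ ≤ ENNReal.ofReal (l ^ n * (K * Y)) * (ENNReal.ofReal (4 ^ n * 2) * mHL u x₀) := by
        rw [lintegral_const_mul' _ _ ENNReal.ofReal_ne_top]
        gcongr
        exact lintegral_enorm_mul_inv_weight_le u.continuous x₀
    _ = _ := by
        rw [← mul_assoc, ← ENNReal.ofReal_mul (by positivity), mul_right_comm (ENNReal.ofReal _),
          ← ENNReal.ofReal_mul (by positivity)]
        congr 2
        ring
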